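/- Lemma (conditional conditions imply joint conditions). Fix m and K. Suppose: (a) ν_k^m(y,R) = ν_k^m(−y,−R) for all rectangles R ∈ ℛ, for u_k^m-almost every y, for all k ≤ K; (b) ν_k^m(y,R) ≤ ν_k^m(y,R') for all R ∈ ℛ_{R₂}, for u_k^m-almost every y, for all k ≤ K; and the initial law is symmetric: P(Y_m(t_0) ∈ I) = P(Y_m(t_0) ∈ {−y : y ∈ I}) for all intervals I ⊂ ℝ. Then for all k ≤ K: if (a) holds then μ_k^m(R) = μ_k^m(−R) for all R ∈ ℛ (condition (i) of Theorem 1), and if (b) holds then μ_k^m(R) ≤ μ_k^m(R') for all R ∈ ℛ_{R₂} (condition (ii) of Theorem 1). In particular the laws u_k^m remain symmetric about 0 for all k ≤ K. -/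

import Mathlib

open MeasureTheory Set ProbabilityTheory
open scoped ENNReal

noncomputable section

/-- A rectangle in `ℝ²`: a product of two intervals (= order-connected subsets of `ℝ`). -/
def IsRectangle (R : Set (ℝ × ℝ)) : Prop :=
  ∃ I₁ I₂ : Set ℝ, I₁.OrdConnected ∧ I₂.OrdConnected ∧ R = I₁ ×ˢ I₂

/-- The reflection `A' = {(x, −x−y) : (x,y) ∈ A}`. -/
def reflP (A : Set (ℝ × ℝ)) : Set (ℝ × ℝ) := (fun p : ℝ × ℝ => (p.1, -p.1 - p.2)) '' A

/-- `R₂ = {(y,d) : y > 0, d > −y/2}`. -/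
def R2set : Set (ℝ × ℝ) := {p : ℝ × ℝ | 0 < p.1 ∧ -(1/2) * p.1 < p.2}

theorem IsRectangle.measurableSet {R : Set (ℝ × ℝ)} (hR : IsRectangle R) : MeasurableSet R := by
  obtain ⟨I, J, hI, hJ, rfl⟩ := hR
  exact hI.measurableSet.prod hJ.measurableSet

theorem measurableSet_R2set : MeasurableSet R2set :=
  (measurableSet_lt measurable_const measurable_fst).inter
    (measurableSet_lt (measurable_fst.const_mul _) measurable_snd)

theorem MeasurableSet.reflP {A : Set (ℝ × ℝ)} (hA : MeasurableSet A) :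
    MeasurableSet (reflP A) := by
  have hinv : Function.Involutive (fun p : ℝ × ℝ => (p.1, -p.1 - p.2)) := fun p => by
    simp
  rw [_root_.reflP, hinv.image_eq_preimage_symm]
  exact (by fun_prop : Measurable fun p : ℝ × ℝ => (p.1, -p.1 - p.2)) hA

theorem generateFrom_ordConnected :
    MeasurableSpace.generateFrom {I : Set ℝ | I.OrdConnected} = Real.measurableSpace := by
  refine le_antisymm (MeasurableSpace.generateFrom_le fun I hI => OrdConnected.measurableSet hI) ?_
  rw [BorelSpace.measurable_eq (α := ℝ), borel_eq_generateFrom_Iic]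
  refine MeasurableSpace.generateFrom_mono ?_
  rintro _ ⟨a, rfl⟩
  exact ordConnected_Iic

/-- Finite measures on the plane which agree on rectangles are equal. -/
theorem ext_of_isRectangle {μ ν : Measure (ℝ × ℝ)} [IsFiniteMeasure μ]
    (h : ∀ R, IsRectangle R → μ R = ν R) : μ = ν := by
  have hspan : IsCountablySpanning {I : Set ℝ | I.OrdConnected} :=
    ⟨fun _ => univ, fun _ => ordConnected_univ, iUnion_const _⟩
  have hpi : IsPiSystem {I : Set ℝ | I.OrdConnected} :=
    fun I hI J hJ _ => OrdConnected.inter hI hJ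
  refine ext_of_generate_finite _
    (generateFrom_eq_prod generateFrom_ordConnected generateFrom_ordConnected hspan hspan).symm
    (hpi.prod hpi) ?_ ?_
  · rintro _ ⟨I, hI, J, hJ, rfl⟩
    exact h _ ⟨I, J, hI, hJ, rfl⟩
  · exact h _ ⟨univ, univ, ordConnected_univ, ordConnected_univ, univ_prod_univ.symm⟩

theorem map_neg_eq_of_ordConnected {u : Measure ℝ} [IsFiniteMeasure u]
    (h : ∀ I : Set ℝ, I.OrdConnected → u I = u (-I)) : u.map Neg.neg = u :=
  (Measure.ext_of_Iic _ _ fun a => by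
    rw [Measure.map_apply measurable_neg measurableSet_Iic]
    exact h _ ordConnected_Iic).symm

theorem map_neg_eq_of_isRectangle {μ : Measure (ℝ × ℝ)} [IsFiniteMeasure μ]
    (h : ∀ R, IsRectangle R → μ R = μ (-R)) : μ.map Neg.neg = μ :=
  (ext_of_isRectangle fun R hR => by
    rw [Measure.map_apply measurable_neg hR.measurableSet]
    exact h R hR).symm

/-- If a symmetric law `u` and a kernel `κ` with `κ y R = κ (-y) (-R)` on rectangles disintegrate
`μ`, then `μ` is symmetric on rectangles. -/
theorem measure_neg_eq_of_disintegration {u : Measure ℝ} {μ : Measure (ℝ × ℝ)}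
    {κ : Kernel ℝ (ℝ × ℝ)} (hu : u.map Neg.neg = u)
    (hdis : ∀ B, MeasurableSet B → μ B = ∫⁻ y, κ y B ∂u)
    (hκ : ∀ᵐ y ∂u, ∀ R, IsRectangle R → κ y R = κ (-y) (-R))
    {R : Set (ℝ × ℝ)} (hR : IsRectangle R) : μ R = μ (-R) := by
  have hnegR : MeasurableSet (-R) := measurable_neg hR.measurableSet
  calc μ R = ∫⁻ y, κ y R ∂u := hdis R hR.measurableSet
    _ = ∫⁻ y, κ (-y) (-R) ∂u := lintegral_congr_ae (hκ.mono fun y hy => hy R hR)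
    _ = ∫⁻ y, κ y (-R) ∂(u.map Neg.neg) :=
      (lintegral_map (κ.measurable_coe hnegR) measurable_neg).symm
    _ = μ (-R) := by rw [hu, hdis _ hnegR]

/-- If the joint law of a variable and its increment is symmetric, then so is the law of the
incremented variable. -/
theorem map_neg_eq_of_increment {Ω : Type*} [MeasurableSpace Ω] {P : Measure Ω} {X Y : Ω → ℝ}
    (hX : Measurable X) (hY : Measurable Y)
    (h : (P.map fun ω => (X ω, Y ω - X ω)).map Neg.neg = P.map fun ω => (X ω, Y ω - X ω)) :
    (P.map Y).map Neg.neg = P.map Y := by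
  have hXY : Measurable fun ω => (X ω, Y ω - X ω) := hX.prodMk (hY.sub hX)
  have hadd : Measurable fun p : ℝ × ℝ => p.1 + p.2 := by fun_prop
  have hmap : P.map Y = (P.map fun ω => (X ω, Y ω - X ω)).map fun p => p.1 + p.2 := by
    rw [Measure.map_map hadd hXY]
    congr 1
    ext ω
    simp
  rw [hmap, Measure.map_map measurable_neg hadd]
  conv_rhs => rw [← h, Measure.map_map hadd measurable_neg]
  congr 1
  ext p
  simp [add_comm]

/-- **Lemma (conditional conditions imply joint conditions).** Let `W k = Y_m(t_k)` be the
reverting process of stock `m`, `u_k` the law of `W k`, `μ_k` the law of `(W k, Δ_k W)` and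
`ν_k` a disintegration of `μ_k` over `u_k`. Assume the initial law is symmetric. Then: if the
conditional symmetry (a) holds for all `k ≤ K`, so do condition (i) of Theorem 1 and the
symmetry of `u_k`; and if the conditional reversion-strength condition (b) holds for all
`k ≤ K`, so does condition (ii) of Theorem 1. -/
theorem conditional_implies_joint
    {Ω : Type*} [MeasurableSpace Ω] (P : Measure Ω) [IsProbabilityMeasure P]
    (W : ℕ → Ω → ℝ) (hW : ∀ k, Measurable (W k)) (K : ℕ)
    (ν : ℕ → ProbabilityTheory.Kernel ℝ (ℝ × ℝ))
    (hmk : ∀ k, ProbabilityTheory.IsMarkovKernel (ν k))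
    -- `ν_k` is a disintegration of `μ_k` over `u_k`
    (hdis : ∀ k, ∀ B : Set (ℝ × ℝ), MeasurableSet B →
      Measure.map (fun ω => (W k ω, W (k+1) ω - W k ω)) P B =
        ∫⁻ y, ν k y B ∂(Measure.map (W k) P))
    -- the initial law is symmetric about `0`
    (hsym0 : ∀ I : Set ℝ, I.OrdConnected →
      Measure.map (W 0) P I = Measure.map (W 0) P (-I)) :
    -- (a) for all `k ≤ K` implies (i) for all `k ≤ K`, and the laws `u_k` stay symmetric
    ((∀ k ≤ K, ∀ᵐ y ∂(Measure.map (W k) P), ∀ R : Set (ℝ × ℝ), IsRectangle R →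
        ν k y R = ν k (-y) (-R)) →
      ∀ k ≤ K,
        (∀ R : Set (ℝ × ℝ), IsRectangle R →
          Measure.map (fun ω => (W k ω, W (k+1) ω - W k ω)) P R =
            Measure.map (fun ω => (W k ω, W (k+1) ω - W k ω)) P (-R)) ∧
        (∀ I : Set ℝ, I.OrdConnected →
          Measure.map (W k) P I = Measure.map (W k) P (-I)))
    ∧
    -- (b) for all `k ≤ K` implies (ii) for all `k ≤ K`
    ((∀ k ≤ K, ∀ᵐ y ∂(Measure.map (W k) P), ∀ S : Set (ℝ × ℝ), IsRectangle S →
        ν k y (R2set ∩ S) ≤ ν k y (reflP (R2set ∩ S))) →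
      ∀ k ≤ K, ∀ S : Set (ℝ × ℝ), IsRectangle S →
        Measure.map (fun ω => (W k ω, W (k+1) ω - W k ω)) P (R2set ∩ S) ≤
          Measure.map (fun ω => (W k ω, W (k+1) ω - W k ω)) P (reflP (R2set ∩ S))) := by
  refine ⟨fun ha => ?_, fun hb k hk S hS => ?_⟩
  · have hjoint : ∀ k ≤ K, (P.map (W k)).map Neg.neg = P.map (W k) →
        ∀ R, IsRectangle R →
          P.map (fun ω => (W k ω, W (k+1) ω - W k ω)) R =
            P.map (fun ω => (W k ω, W (k+1) ω - W k ω)) (-R) :=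
      fun k hk hu R hR => measure_neg_eq_of_disintegration hu (hdis k) (ha k hk) hR
    have hsym : ∀ k ≤ K, (P.map (W k)).map Neg.neg = P.map (W k) := by
      intro k
      induction k with
      | zero => exact fun _ => map_neg_eq_of_ordConnected hsym0
      | succ k ih =>
        intro hk
        have hk' : k ≤ K := k.le_succ.trans hk
        exact map_neg_eq_of_increment (hW k) (hW (k + 1))
          (map_neg_eq_of_isRectangle (hjoint k hk' (ih hk')))
    refine fun k hk => ⟨hjoint k hk (hsym k hk), fun I hI => ?_⟩
    conv_lhs => rw [← hsym k hk, Measure.map_apply measurable_neg hI.measurableSet]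
    rfl
  · have hmeas : MeasurableSet (R2set ∩ S) := measurableSet_R2set.inter hS.measurableSet
    rw [hdis k _ hmeas, hdis k _ hmeas.reflP]
    exact lintegral_mono_ae ((hb k hk).mono fun y hy => hy S hS)
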